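/- For each formula A, the set R_A of all A-removing mappings, equipped with the ultrametric l₂, is a non-empty spherically complete ultrametric space. -/

import Mathlib

inductive Formula : Type
  | atom : ℕ → Formula
  | bot  : Formula
  | imp  : Formula → Formula → Formula
  | box  : Formula → Formula
deriving DecidableEq

def boxtimes (Γ : Multiset Formula) : Multiset Formula := Γ + Γ.map Formula.box

inductive GoSeq : Bool → Multiset Formula → Multiset Formula → Prop
  | ax (c) (Γ Δ : Multiset Formula) (A : Formula) : GoSeq c (A ::ₘ Γ) (A ::ₘ Δ)
  | axBot (c) (Γ Δ : Multiset Formula) : GoSeq c (Formula.bot ::ₘ Γ) Δ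
  | impL (c) (Γ Δ : Multiset Formula) (A B : Formula) :
      GoSeq c (B ::ₘ Γ) Δ → GoSeq c Γ (A ::ₘ Δ) → GoSeq c ((A.imp B) ::ₘ Γ) Δ
  | impR (c) (Γ Δ : Multiset Formula) (A B : Formula) :
      GoSeq c (A ::ₘ Γ) (B ::ₘ Δ) → GoSeq c Γ ((A.imp B) ::ₘ Δ)
  | boxGo (c) (Γ Δ Θ : Multiset Formula) (A : Formula) :
      GoSeq c ((Formula.box (A.imp (Formula.box A))) ::ₘ boxtimes Θ) {A} →
      GoSeq c (Γ + Θ.map Formula.box) ((Formula.box A) ::ₘ Δ)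
  | cut (Γ Δ : Multiset Formula) (A : Formula) :
      GoSeq true Γ (A ::ₘ Δ) → GoSeq true (A ::ₘ Γ) Δ → GoSeq true Γ Δ

inductive Frag : Bool → ℕ → Multiset Formula → Multiset Formula → Type
  | hole (c) (Γ Δ : Multiset Formula) : Frag c 0 Γ Δ
  | axP (c) (n) (Γ Δ : Multiset Formula) (p : ℕ) :
      Frag c (n+1) (Formula.atom p ::ₘ Γ) (Formula.atom p ::ₘ Δ)
  | axBot (c) (n) (Γ Δ : Multiset Formula) : Frag c (n+1) (Formula.bot ::ₘ Γ) Δ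
  | impL (c) (n) (Γ Δ : Multiset Formula) (A B : Formula) :
      Frag c (n+1) (B ::ₘ Γ) Δ → Frag c (n+1) Γ (A ::ₘ Δ) →
      Frag c (n+1) ((A.imp B) ::ₘ Γ) Δ
  | impR (c) (n) (Γ Δ : Multiset Formula) (A B : Formula) :
      Frag c (n+1) (A ::ₘ Γ) (B ::ₘ Δ) → Frag c (n+1) Γ ((A.imp B) ::ₘ Δ)
  | box (c) (n) (Γ Δ Θ : Multiset Formula) (l : List Formula) (h : l ≠ []) :
      Frag c (n+1) (boxtimes Θ) (boxtimes (↑l)) →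
      ((i : Fin l.length) → Frag c n (boxtimes Θ) {l.get i}) →
      Frag c (n+1) (Γ + Θ.map Formula.box) ((↑(l.map Formula.box) : Multiset Formula) + Δ)
  | cut (n) (Γ Δ : Multiset Formula) (A : Formula) :
      Frag true (n+1) Γ (A ::ₘ Δ) → Frag true (n+1) (A ::ₘ Γ) Δ → Frag true (n+1) Γ Δ

def Frag.trunc : ∀ {c : Bool} {n : ℕ} {Γ Δ : Multiset Formula}, Frag c (n+1) Γ Δ → Frag c n Γ Δ
  | c, 0, Γ, Δ, _ => .hole c Γ Δ
  | c, n+1, _, _, .axP _ _ Γ Δ p => .axP c n Γ Δ p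
  | c, n+1, _, _, .axBot _ _ Γ Δ => .axBot c n Γ Δ
  | c, n+1, _, _, .impL _ _ Γ Δ A B a b => .impL c n Γ Δ A B a.trunc b.trunc
  | c, n+1, _, _, .impR _ _ Γ Δ A B a => .impR c n Γ Δ A B a.trunc
  | c, n+1, _, _, .box _ _ Γ Δ Θ l h a bs => .box c n Γ Δ Θ l h a.trunc (fun i => (bs i).trunc)
  | _, n+1, _, _, .cut _ Γ Δ A a b => .cut n Γ Δ A a.trunc b.trunc

def Frag.height : ∀ {c : Bool} {n : ℕ} {Γ Δ : Multiset Formula}, Frag c n Γ Δ → ℕ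
  | _, _, _, _, .hole _ _ _ => 0
  | _, _, _, _, .axP _ _ _ _ _ => 0
  | _, _, _, _, .axBot _ _ _ _ => 0
  | _, _, _, _, .impL _ _ _ _ _ _ a b => max a.height b.height + 1
  | _, _, _, _, .impR _ _ _ _ _ _ a => a.height + 1
  | _, _, _, _, .box _ _ _ _ _ _ _ a bs =>
      max a.height (Finset.univ.sup fun i => (bs i).height) + 1
  | _, _, _, _, .cut _ _ _ _ a b => max a.height b.height + 1

def Frag.cutFree : ∀ {c : Bool} {n : ℕ} {Γ Δ : Multiset Formula}, Frag c n Γ Δ → Prop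
  | _, _, _, _, .hole _ _ _ => True
  | _, _, _, _, .axP _ _ _ _ _ => True
  | _, _, _, _, .axBot _ _ _ _ => True
  | _, _, _, _, .impL _ _ _ _ _ _ a b => a.cutFree ∧ b.cutFree
  | _, _, _, _, .impR _ _ _ _ _ _ a => a.cutFree
  | _, _, _, _, .box _ _ _ _ _ _ _ a bs => a.cutFree ∧ ∀ i, (bs i).cutFree
  | _, _, _, _, .cut _ _ _ _ _ _ => False

structure InfProof (c : Bool) (Γ Δ : Multiset Formula) : Type where
  frag : ∀ n : ℕ, Frag c n Γ Δ
  compat : ∀ n : ℕ, (frag (n+1)).trunc = frag n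

structure PP : Type where
  Γ : Multiset Formula
  Δ : Multiset Formula
  prf : InfProof true Γ Δ

def Sim : ℕ → PP → PP → Prop
  | 0, _, _ => True
  | n+1, π, τ => π.Γ = τ.Γ ∧ π.Δ = τ.Δ ∧ HEq (π.prf.frag (n+1)) (τ.prf.frag (n+1))

noncomputable def dP (π τ : PP) : ℝ :=
  sInf {r : ℝ | ∃ n : ℕ, Sim n π τ ∧ r = (1/2 : ℝ) ^ n}

def localHeight (π : PP) : ℕ := (π.prf.frag 1).height

def Pmem (n : ℕ) (π : PP) : Prop := (π.prf.frag n).cutFree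

def IsUltrametric {M : Type*} (d : M → M → ℝ) : Prop :=
  (∀ x y, 0 ≤ d x y) ∧ (∀ x y, d x y = 0 ↔ x = y) ∧ (∀ x y, d x y = d y x) ∧
  (∀ x y z, d x z ≤ max (d x y) (d y z))

def cBall {M : Type*} (d : M → M → ℝ) (x : M) (r : ℝ) : Set M := {y | d x y ≤ r}

def SphericallyComplete {M : Type*} (d : M → M → ℝ) : Prop :=
  ∀ (c : ℕ → M) (r : ℕ → ℝ), (∀ n, 0 ≤ r n) →
    (∀ n, cBall d (c (n+1)) (r (n+1)) ⊆ cBall d (c n) (r n)) →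
    ∃ x, ∀ n, x ∈ cBall d (c n) (r n)

def NonExpansive1 (u : PP → PP) : Prop := ∀ π τ, dP (u π) (u τ) ≤ dP π τ

def Adequate1 (u : PP → PP) : Prop := ∀ n π, Pmem n π → Pmem n (u π)

noncomputable def dPm {m : ℕ} (x y : Fin m → PP) : ℝ := ⨆ i, dP (x i) (y i)

def NonExpansiveM {m : ℕ} (u : (Fin m → PP) → PP) : Prop :=
  ∀ x y, dP (u x) (u y) ≤ dPm x y

def Fm (m : ℕ) : Type := {u : (Fin m → PP) → PP // NonExpansiveM u}

def SimF {m : ℕ} (n k : ℕ) (a b : (Fin m → PP) → PP) : Prop :=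
  (∀ x, Sim n (a x) (b x)) ∧
  (∀ x, (∑ i, localHeight (x i)) < k → Sim (n+1) (a x) (b x))

noncomputable def lm {m : ℕ} (a b : (Fin m → PP) → PP) : ℝ :=
  (1/2) * sInf {r : ℝ | ∃ n k : ℕ, SimF n k a b ∧ r = (1/2 : ℝ) ^ n + (1/2 : ℝ) ^ (n + k)}

noncomputable def dP2 (p q : PP × PP) : ℝ := max (dP p.1 q.1) (dP p.2 q.2)

def NonExpansive2 (u : PP × PP → PP) : Prop := ∀ p q, dP (u p) (u q) ≤ dP2 p q

def Adequate2 (u : PP × PP → PP) : Prop :=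
  ∀ n π τ, Pmem n π → Pmem n τ → Pmem n (u (π, τ))

def Removing (A : Formula) (u : PP × PP → PP) : Prop :=
  ∀ (Γ Δ : Multiset Formula) (π τ : PP),
    π.Γ = Γ → π.Δ = A ::ₘ Δ → τ.Γ = A ::ₘ Γ → τ.Δ = Δ →
    (u (π, τ)).Γ = Γ ∧ (u (π, τ)).Δ = Δ

def RA (A : Formula) : Type := {u : PP × PP → PP // NonExpansive2 u ∧ Removing A u}

def SimF2 (n k : ℕ) (a b : PP × PP → PP) : Prop :=
  (∀ p, Sim n (a p) (b p)) ∧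
  (∀ p : PP × PP, localHeight p.1 + localHeight p.2 < k → Sim (n+1) (a p) (b p))

noncomputable def l2 (a b : PP × PP → PP) : ℝ :=
  (1/2) * sInf {r : ℝ | ∃ n k : ℕ, SimF2 n k a b ∧ r = (1/2 : ℝ) ^ n + (1/2 : ℝ) ^ (n + k)}

theorem Sim.refl (n : ℕ) (π : PP) : Sim n π π := by
  cases n with
  | zero => trivial
  | succ n => exact ⟨rfl, rfl, HEq.rfl⟩

theorem Sim.symm {n : ℕ} {π τ : PP} (h : Sim n π τ) : Sim n τ π := by
  cases n with
  | zero => trivial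
  | succ n => exact ⟨h.1.symm, h.2.1.symm, h.2.2.symm⟩

theorem Sim.trans {n : ℕ} {π τ σ : PP} (h : Sim n π τ) (h' : Sim n τ σ) : Sim n π σ := by
  cases n with
  | zero => trivial
  | succ n => exact ⟨h.1.trans h'.1, h.2.1.trans h'.2.1, h.2.2.trans h'.2.2⟩

theorem Sim.of_succ {n : ℕ} {π τ : PP} (h : Sim (n + 1) π τ) : Sim n π τ := by
  cases n with
  | zero => trivial
  | succ n =>
    obtain ⟨Γ, Δ, f⟩ := π
    obtain ⟨Γ', Δ', g⟩ := τ
    obtain ⟨h₁, h₂, h₃⟩ := h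
    dsimp only at h₁ h₂ h₃
    subst h₁ h₂
    refine ⟨rfl, rfl, heq_of_eq ?_⟩
    dsimp only
    rw [← f.compat, ← g.compat, eq_of_heq h₃]

theorem Sim.mono {m n : ℕ} (hmn : m ≤ n) {π τ : PP} (h : Sim n π τ) : Sim m π τ := by
  induction hmn with
  | refl => exact h
  | step _ ih => exact ih h.of_succ

theorem Sim.localHeight_eq {π τ : PP} (h : Sim 1 π τ) : localHeight π = localHeight τ := by
  obtain ⟨Γ, Δ, f⟩ := π
  obtain ⟨Γ', Δ', g⟩ := τ
  obtain ⟨h₁, h₂, h₃⟩ := h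
  dsimp only at h₁ h₂ h₃
  subst h₁ h₂
  exact congrArg Frag.height (eq_of_heq h₃)

theorem Frag.eq_of_zero {c : Bool} {Γ Δ : Multiset Formula} (a b : Frag c 0 Γ Δ) : a = b := by
  cases a
  cases b
  rfl

theorem eq_of_forall_sim {π τ : PP} (h : ∀ n, Sim n π τ) : π = τ := by
  obtain ⟨Γ, Δ, f, hf⟩ := π
  obtain ⟨Γ', Δ', g, hg⟩ := τ
  obtain ⟨h₁, h₂, -⟩ := h 1
  dsimp only at h₁ h₂
  subst h₁ h₂
  have : f = g := by
    funext n
    cases n with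
    | zero => exact Frag.eq_of_zero _ _
    | succ n => exact eq_of_heq (h (n + 1)).2.2
  subst this
  rfl

theorem bddBelow_dP (π τ : PP) :
    BddBelow {r : ℝ | ∃ n : ℕ, Sim n π τ ∧ r = (1/2 : ℝ) ^ n} :=
  ⟨0, by rintro r ⟨n, -, rfl⟩; positivity⟩

theorem dP_le_of_sim {n : ℕ} {π τ : PP} (h : Sim n π τ) : dP π τ ≤ (1/2 : ℝ) ^ n :=
  csInf_le (bddBelow_dP π τ) ⟨n, h, rfl⟩

theorem exists_sim_of_dP_lt {π τ : PP} {r : ℝ} (h : dP π τ < r) :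
    ∃ n, Sim n π τ ∧ (1/2 : ℝ) ^ n < r := by
  obtain ⟨_, ⟨n, hn, rfl⟩, hr⟩ := exists_lt_of_csInf_lt (by exact ⟨_, 0, trivial, rfl⟩) h
  exact ⟨n, hn, hr⟩

theorem dP_le_iff {n : ℕ} {π τ : PP} : dP π τ ≤ (1/2 : ℝ) ^ n ↔ Sim n π τ := by
  refine ⟨fun h => ?_, dP_le_of_sim⟩
  cases n with
  | zero => trivial
  | succ n =>
    have hlt : (1/2 : ℝ) ^ (n + 1) < (1/2 : ℝ) ^ n :=
      pow_lt_pow_right_of_lt_one₀ (by norm_num) (by norm_num) n.lt_succ_self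
    obtain ⟨m, hm, hmn⟩ := exists_sim_of_dP_lt (h.trans_lt hlt)
    exact hm.mono ((pow_lt_pow_iff_right_of_lt_one₀ (by norm_num) (by norm_num)).1 hmn)

theorem nonExpansive2_iff {u : PP × PP → PP} :
    NonExpansive2 u ↔ ∀ n p q, Sim n p.1 q.1 → Sim n p.2 q.2 → Sim n (u p) (u q) := by
  constructor
  · intro h n p q h₁ h₂
    exact dP_le_iff.1 ((h p q).trans (max_le (dP_le_of_sim h₁) (dP_le_of_sim h₂)))
  · intro h p q
    refine le_of_forall_gt fun r hr => ?_
    obtain ⟨h₁, h₂⟩ := max_lt_iff.1 hr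
    obtain ⟨n₁, s₁, hn₁⟩ := exists_sim_of_dP_lt h₁
    obtain ⟨n₂, s₂, hn₂⟩ := exists_sim_of_dP_lt h₂
    have hs := dP_le_of_sim (h (min n₁ n₂) p q (s₁.mono (min_le_left _ _))
      (s₂.mono (min_le_right _ _)))
    rcases min_choice n₁ n₂ with e | e <;> rw [e] at hs <;> linarith

/-- The ∞-proof obtained by joining two ∞-proofs with the cut rule. -/
def InfProof.cut {Γ Δ : Multiset Formula} {A : Formula} (f : InfProof true Γ (A ::ₘ Δ))
    (g : InfProof true (A ::ₘ Γ) Δ) : InfProof true Γ Δ where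
  frag
    | 0 => .hole true Γ Δ
    | n + 1 => .cut n Γ Δ A (f.frag (n + 1)) (g.frag (n + 1))
  compat
    | 0 => Frag.eq_of_zero _ _
    | n + 1 => by simp only [Frag.trunc, f.compat, g.compat]

open Classical in
/-- Apply the cut rule with cut formula `A` to cut pairs, and project to the first component
elsewhere. -/
noncomputable def cutMap (A : Formula) (p : PP × PP) : PP :=
  if h : p.1.Δ = A ::ₘ p.2.Δ ∧ p.2.Γ = A ::ₘ p.1.Γ then
    ⟨p.1.Γ, p.2.Δ, InfProof.cut (A := A) (h.1 ▸ p.1.prf) (h.2 ▸ p.2.prf)⟩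
  else p.1

theorem cutMap_removing (A : Formula) : Removing A (cutMap A) := by
  rintro Γ Δ π τ rfl h₁ h₂ rfl
  have h : π.Δ = A ::ₘ τ.Δ ∧ τ.Γ = A ::ₘ π.Γ := ⟨h₁, h₂⟩
  simp [cutMap, h]

theorem cutMap_nonExpansive2 (A : Formula) : NonExpansive2 (cutMap A) := by
  rw [nonExpansive2_iff]
  rintro n ⟨⟨Γ, Δ, f⟩, ⟨Γ', Δ', g⟩⟩ ⟨⟨Γ₁, Δ₁, f₁⟩, ⟨Γ₁', Δ₁', g₁⟩⟩ h h'
  cases n with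
  | zero => trivial
  | succ n =>
    obtain ⟨e₁, e₂, e₃⟩ := h
    obtain ⟨e₁', e₂', e₃'⟩ := h'
    dsimp only at e₁ e₂ e₃ e₁' e₂' e₃'
    subst e₁ e₂ e₁' e₂'
    by_cases hc : Δ = A ::ₘ Δ' ∧ Γ' = A ::ₘ Γ
    · obtain ⟨rfl, rfl⟩ := hc
      simp only [cutMap, and_self, dite_true]
      refine ⟨rfl, rfl, heq_of_eq ?_⟩
      simp only [InfProof.cut]
      rw [eq_of_heq e₃, eq_of_heq e₃']
    · simp only [cutMap, hc, dite_false]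
      exact ⟨rfl, rfl, e₃⟩

/-- Cauchy sequences of ∞-proofs converge. -/
theorem exists_forall_sim (c : ℕ → PP) (h : ∀ n, Sim n (c n) (c (n + 1))) :
    ∃ π, ∀ n, Sim n (c n) π := by
  have hseq : ∀ n, (c (n + 1)).Γ = (c 1).Γ ∧ (c (n + 1)).Δ = (c 1).Δ := by
    intro n
    induction n with
    | zero => exact ⟨rfl, rfl⟩
    | succ n ih => exact ⟨(h (n + 1)).1.symm.trans ih.1, (h (n + 1)).2.1.symm.trans ih.2⟩
  have hex : ∀ n, ∃ F : InfProof true (c 1).Γ (c 1).Δ,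
      c (n + 1) = ⟨(c 1).Γ, (c 1).Δ, F⟩ := by
    intro n
    obtain ⟨h₁, h₂⟩ := hseq n
    rw [← h₁, ← h₂]
    exact ⟨(c (n + 1)).prf, rfl⟩
  choose F hF using hex
  have hFs : ∀ n, (F n).frag (n + 1) = (F (n + 1)).frag (n + 1) := by
    intro n
    have := h (n + 1)
    rw [hF n, hF (n + 1)] at this
    exact eq_of_heq this.2.2
  let G : InfProof true (c 1).Γ (c 1).Δ :=
    { frag := fun
        | 0 => .hole _ _ _
        | n + 1 => (F n).frag (n + 1)
      compat := fun
        | 0 => Frag.eq_of_zero _ _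
        | n + 1 => ((F (n + 1)).compat (n + 1)).trans (hFs n).symm }
  refine ⟨⟨_, _, G⟩, fun n => ?_⟩
  cases n with
  | zero => trivial
  | succ n =>
    rw [hF n]
    exact ⟨rfl, rfl, HEq.rfl⟩

/-- A sequence whose tails are controlled by unbounded levels has a limit at these levels. -/
theorem exists_forall_sim_of_unbounded (c : ℕ → PP) (e : ℕ → ℕ)
    (h : ∀ m n, m ≤ n → Sim (e m) (c m) (c n)) (he : ∀ j, ∃ m, j ≤ e m) :
    ∃ π, ∀ m, Sim (e m) (c m) π := by
  choose s hs using he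
  have hcs : ∀ {i j k}, k ≤ e i → k ≤ e j → Sim k (c i) (c j) := by
    intro i j k hi hj
    rcases le_total i j with hij | hij
    · exact (h i j hij).mono hi
    · exact ((h j i hij).mono hj).symm
  obtain ⟨π, hπ⟩ := exists_forall_sim (fun j => c (s j))
    fun n => hcs (hs n) ((Nat.le_succ n).trans (hs (n + 1)))
  exact ⟨π, fun m => (hcs le_rfl (hs (e m))).trans (hπ (e m))⟩

theorem SimF2.symm {n k : ℕ} {a b : PP × PP → PP} (h : SimF2 n k a b) : SimF2 n k b a :=
  ⟨fun p => (h.1 p).symm, fun p hp => (h.2 p hp).symm⟩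

theorem SimF2.trans {n k : ℕ} {a b c : PP × PP → PP} (h : SimF2 n k a b) (h' : SimF2 n k b c) :
    SimF2 n k a c :=
  ⟨fun p => (h.1 p).trans (h'.1 p), fun p hp => (h.2 p hp).trans (h'.2 p hp)⟩

theorem simF2_zero (a b : PP × PP → PP) : SimF2 0 0 a b :=
  ⟨fun _ => trivial, fun _ hp => absurd hp (Nat.not_lt_zero _)⟩

theorem SimF2.mono {n k n' k' : ℕ} {a b : PP × PP → PP} (h : SimF2 n k a b)
    (hle : n' < n ∨ n' = n ∧ k' ≤ k) : SimF2 n' k' a b := by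
  rcases hle with hlt | ⟨rfl, hk⟩
  · exact ⟨fun p => (h.1 p).mono hlt.le, fun p _ => (h.1 p).mono hlt⟩
  · exact ⟨h.1, fun p hp => h.2 p (hp.trans_le hk)⟩

theorem half_pow_add_le {n k n' k' : ℕ} (hle : n' < n ∨ n' = n ∧ k' ≤ k) :
    (1/2 : ℝ) ^ n + (1/2 : ℝ) ^ (n + k) ≤ (1/2 : ℝ) ^ n' + (1/2 : ℝ) ^ (n' + k') := by
  have anti : ∀ {i j : ℕ}, i ≤ j → (1/2 : ℝ) ^ j ≤ (1/2 : ℝ) ^ i := fun hij =>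
    pow_le_pow_of_le_one (by norm_num) (by norm_num) hij
  rcases hle with hlt | ⟨rfl, hk⟩
  · have h₁ := anti (Nat.succ_le_of_lt hlt)
    have h₂ := anti (Nat.le_add_right n k)
    have h₃ : (0 : ℝ) < (1/2) ^ (n' + k') := by positivity
    rw [pow_succ] at h₁
    linarith
  · have := anti (Nat.add_le_add_left hk n')
    linarith

theorem bddBelow_l2 (a b : PP × PP → PP) :
    BddBelow {r : ℝ | ∃ n k : ℕ, SimF2 n k a b ∧ r = (1/2 : ℝ) ^ n + (1/2 : ℝ) ^ (n + k)} :=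
  ⟨0, by rintro r ⟨n, k, -, rfl⟩; positivity⟩

theorem l2_le_of_simF2 {n k : ℕ} {a b : PP × PP → PP} (h : SimF2 n k a b) :
    l2 a b ≤ 1/2 * ((1/2 : ℝ) ^ n + (1/2 : ℝ) ^ (n + k)) :=
  mul_le_mul_of_nonneg_left (csInf_le (bddBelow_l2 a b) ⟨n, k, h, rfl⟩) (by norm_num)

theorem exists_simF2_of_l2_lt {a b : PP × PP → PP} {r : ℝ} (h : l2 a b < r) :
    ∃ n k, SimF2 n k a b ∧ 1/2 * ((1/2 : ℝ) ^ n + (1/2 : ℝ) ^ (n + k)) < r := by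
  have h' : sInf {r : ℝ | ∃ n k : ℕ, SimF2 n k a b ∧
      r = (1/2 : ℝ) ^ n + (1/2 : ℝ) ^ (n + k)} < 2 * r := by
    unfold l2 at h
    linarith
  obtain ⟨_, ⟨n, k, hn, rfl⟩, hr⟩ :=
    exists_lt_of_csInf_lt (by exact ⟨_, 0, 0, simF2_zero a b, rfl⟩) h'
  exact ⟨n, k, hn, by linarith⟩

theorem l2_nonneg (a b : PP × PP → PP) : 0 ≤ l2 a b := by
  refine mul_nonneg (by norm_num) (Real.sInf_nonneg ?_)
  rintro r ⟨n, k, -, rfl⟩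
  positivity

theorem l2_comm (a b : PP × PP → PP) : l2 a b = l2 b a := by
  have h : ∀ n k, SimF2 n k a b ↔ SimF2 n k b a := fun n k => ⟨SimF2.symm, SimF2.symm⟩
  simp only [l2, h]

theorem l2_self (a : PP × PP → PP) : l2 a a = 0 := by
  refine le_antisymm (le_of_forall_gt fun r hr => ?_) (l2_nonneg a a)
  obtain ⟨n, hn⟩ := exists_pow_lt_of_lt_one hr (by norm_num : (1/2 : ℝ) < 1)
  have := l2_le_of_simF2 (n := n) (k := 0) (a := a) (b := a)
    ⟨fun p => Sim.refl _ _, fun p _ => Sim.refl _ _⟩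
  rw [add_zero] at this
  linarith

theorem eq_of_l2_eq_zero {a b : PP × PP → PP} (h : l2 a b = 0) : a = b := by
  funext p
  refine eq_of_forall_sim fun n => ?_
  obtain ⟨m, k, hs, hlt⟩ := exists_simF2_of_l2_lt
    (h.trans_lt (by positivity : (0 : ℝ) < (1/2) ^ (n + 1)))
  have hk : (0 : ℝ) < (1/2) ^ (m + k) := by positivity
  rw [pow_succ] at hlt
  exact (hs.1 p).mono ((pow_lt_pow_iff_right_of_lt_one₀ (a := (1/2 : ℝ)) (by norm_num)
    (by norm_num)).1 (by linarith)).le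

theorem l2_le_max (a b c : PP × PP → PP) : l2 a c ≤ max (l2 a b) (l2 b c) := by
  refine le_of_forall_gt fun r hr => ?_
  obtain ⟨h₁, h₂⟩ := max_lt_iff.1 hr
  obtain ⟨n₁, k₁, s₁, hr₁⟩ := exists_simF2_of_l2_lt h₁
  obtain ⟨n₂, k₂, s₂, hr₂⟩ := exists_simF2_of_l2_lt h₂
  by_cases hle : n₁ < n₂ ∨ n₁ = n₂ ∧ k₁ ≤ k₂
  · exact (l2_le_of_simF2 (s₁.trans (s₂.mono hle))).trans_lt hr₁
  · exact (l2_le_of_simF2 ((s₁.mono (by omega)).trans s₂)).trans_lt hr₂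

/-- Every closed `l2`-ball of positive radius is a class of one of the relations `SimF2 n k`. -/
theorem exists_l2_le_iff {r : ℝ} (hr : 0 < r) :
    ∃ n k, ∀ a b : PP × PP → PP, l2 a b ≤ r ↔ SimF2 n k a b := by
  classical
  have hN : ∃ n k : ℕ, 1/2 * ((1/2 : ℝ) ^ n + (1/2 : ℝ) ^ (n + k)) ≤ r := by
    obtain ⟨n, hn⟩ := exists_pow_lt_of_lt_one hr (by norm_num : (1/2 : ℝ) < 1)
    exact ⟨n, 0, by rw [add_zero]; linarith⟩
  have hK := Nat.find_spec hN
  have hmin : ∀ {m}, m < Nat.find hN → ∀ k : ℕ,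
      r < 1/2 * ((1/2 : ℝ) ^ m + (1/2 : ℝ) ^ (m + k)) := fun hm k =>
    not_le.1 fun hle => Nat.find_min hN hm ⟨k, hle⟩
  revert hK hmin
  generalize Nat.find hN = N
  intro hK hmin
  refine ⟨N, Nat.find hK, fun a b => ⟨fun hab => ?_, fun hs =>
    (l2_le_of_simF2 hs).trans (Nat.find_spec hK)⟩⟩
  have hminK : ∀ {k}, k < Nat.find hK → r < 1/2 * ((1/2 : ℝ) ^ N + (1/2 : ℝ) ^ (N + k)) :=
    fun hk => not_le.1 (Nat.find_min hK hk)
  revert hminK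
  generalize Nat.find hK = K
  intro hminK
  have key : ∀ {n k : ℕ}, r < 1/2 * ((1/2 : ℝ) ^ n + (1/2 : ℝ) ^ (n + k)) →
      ∃ n' k', SimF2 n' k' a b ∧ ¬ (n' < n ∨ n' = n ∧ k' ≤ k) := by
    intro n k hlt
    obtain ⟨n', k', hs, hr'⟩ := exists_simF2_of_l2_lt (hab.trans_lt hlt)
    refine ⟨n', k', hs, fun hle => ?_⟩
    have := half_pow_add_le hle
    linarith
  cases K with
  | succ K =>
    obtain ⟨n', k', hs, hle⟩ := key (hminK K.lt_succ_self)
    exact hs.mono (by omega)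
  | zero =>
    cases N with
    | zero => exact simF2_zero a b
    | succ M =>
      refine ⟨fun p => ?_, fun _ hp => absurd hp (Nat.not_lt_zero _)⟩
      obtain ⟨n', k', hs, hle⟩ :=
        key (hmin M.lt_succ_self (localHeight p.1 + localHeight p.2 + 1))
      exact (hs.mono (n' := M) (k' := localHeight p.1 + localHeight p.2 + 1) (by omega)).2 p
        (Nat.lt_succ_self _)

theorem simF2_iff {n k : ℕ} {a b : PP × PP → PP} :
    SimF2 n k a b ↔
      ∀ p, Sim (if localHeight p.1 + localHeight p.2 < k then n + 1 else n) (a p) (b p) := by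
  constructor
  · intro h p
    split_ifs with hp
    · exact h.2 p hp
    · exact h.1 p
  · intro h
    refine ⟨fun p => ?_, fun p hp => ?_⟩
    · have := h p
      split_ifs at this with hp
      · exact this.of_succ
      · exact this
    · simpa [hp] using h p

theorem isUltrametric_l2 (A : Formula) : IsUltrametric (fun a b : RA A => l2 a.1 b.1) :=
  ⟨fun a b => l2_nonneg a.1 b.1,
    fun a _ => ⟨fun h => Subtype.ext (eq_of_l2_eq_zero h), fun h => h ▸ l2_self a.1⟩,
    fun a b => l2_comm a.1 b.1, fun a b c => l2_le_max a.1 b.1 c.1⟩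

/-- A sequence of `A`-removing maps whose tails are controlled, at each argument, by levels
depending only on the local heights has a limit at these levels. -/
theorem exists_removing_limit {A : Formula} (c : ℕ → RA A) (E : ℕ → ℕ → ℕ)
    (h : ∀ m n, m ≤ n → ∀ p : PP × PP,
      Sim (E m (localHeight p.1 + localHeight p.2)) ((c m).1 p) ((c n).1 p)) :
    ∃ x : RA A, ∀ m p,
      Sim (E m (localHeight p.1 + localHeight p.2)) ((c m).1 p) (x.1 p) := by
  have hne : ∀ m n p q, Sim n p.1 q.1 → Sim n p.2 q.2 → Sim n ((c m).1 p) ((c m).1 q) :=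
    fun m => nonExpansive2_iff.1 (c m).2.1
  have level : ∀ s, ∃ f : PP × PP → PP, ∀ p, localHeight p.1 + localHeight p.2 = s →
      (∀ m, Sim (E m s) ((c m).1 p) (f p)) ∧
      (∃ m, ((c m).1 p).Γ = (f p).Γ ∧ ((c m).1 p).Δ = (f p).Δ) ∧
      ∀ q, localHeight q.1 + localHeight q.2 = s → ∀ n, Sim n p.1 q.1 → Sim n p.2 q.2 →
        Sim n (f p) (f q) := by
    intro s
    by_cases hb : ∃ m₀, ∀ m, E m s ≤ E m₀ s
    · obtain ⟨m₀, hm₀⟩ := hb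
      refine ⟨(c m₀).1, fun p hp => ⟨fun m => ?_, ⟨m₀, rfl, rfl⟩, fun q _ n => hne m₀ n p q⟩⟩
      subst hp
      rcases le_total m m₀ with hm | hm
      · exact h m m₀ hm p
      · exact ((h m₀ m hm p).mono (hm₀ m)).symm
    · have hub : ∀ j, ∃ m, j ≤ E m s := by
        push Not at hb
        intro j
        induction j with
        | zero => exact ⟨0, Nat.zero_le _⟩
        | succ j ih =>
          obtain ⟨m, hm⟩ := ih
          obtain ⟨m', hm'⟩ := hb m
          exact ⟨m', by omega⟩
      have hlim : ∀ p : PP × PP, ∃ y, localHeight p.1 + localHeight p.2 = s →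
          ∀ m, Sim (E m s) ((c m).1 p) y := by
        intro p
        by_cases hp : localHeight p.1 + localHeight p.2 = s
        · subst hp
          obtain ⟨y, hy⟩ := exists_forall_sim_of_unbounded (fun m => (c m).1 p) _
            (fun m n hmn => h m n hmn p) hub
          exact ⟨y, fun _ => hy⟩
        · exact ⟨p.1, fun hp' => absurd hp' hp⟩
      choose f hf using hlim
      refine ⟨f, fun p hp => ⟨hf p hp, ?_, fun q hq n h₁ h₂ => ?_⟩⟩
      · obtain ⟨m, hm⟩ := hub 1
        have := (hf p hp m).mono hm
        exact ⟨m, this.1, this.2.1⟩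
      · obtain ⟨m, hm⟩ := hub n
        exact (((hf p hp m).mono hm).symm.trans (hne m n p q h₁ h₂)).trans ((hf q hq m).mono hm)
  choose f hf using level
  refine ⟨⟨fun p => f (localHeight p.1 + localHeight p.2) p, nonExpansive2_iff.2 ?_, ?_⟩,
    fun m p => (hf _ p rfl).1 m⟩
  · intro n p q h₁ h₂
    cases n with
    | zero => trivial
    | succ n =>
      have hh : localHeight p.1 + localHeight p.2 = localHeight q.1 + localHeight q.2 := by
        rw [(h₁.mono (Nat.le_add_left 1 n)).localHeight_eq,
          (h₂.mono (Nat.le_add_left 1 n)).localHeight_eq]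
      have := (hf _ p rfl).2.2 q hh.symm (n + 1) h₁ h₂
      simpa only [← hh] using this
  · intro Γ Δ π τ h₁ h₂ h₃ h₄
    obtain ⟨m, hΓ, hΔ⟩ := (hf _ (π, τ) rfl).2.1
    obtain ⟨hΓ', hΔ'⟩ := (c m).2.2 Γ Δ π τ h₁ h₂ h₃ h₄
    exact ⟨hΓ.symm.trans hΓ', hΔ.symm.trans hΔ'⟩

theorem sphericallyComplete_l2 (A : Formula) :
    SphericallyComplete (fun a b : RA A => l2 a.1 b.1) := by
  intro c r hr hsub
  have hball : ∀ m n, m ≤ n → l2 (c m).1 (c n).1 ≤ r m := by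
    intro m n hmn
    have hanti := antitone_nat_of_succ_le
      (f := fun n => cBall (fun a b : RA A => l2 a.1 b.1) (c n) (r n)) hsub hmn
    exact hanti (show l2 (c n).1 (c n).1 ≤ r n from (l2_self _).trans_le (hr n))
  by_cases hz : ∃ m₀, r m₀ = 0
  · obtain ⟨m₀, hm₀⟩ := hz
    refine ⟨c m₀, fun m => ?_⟩
    change l2 (c m).1 (c m₀).1 ≤ r m
    rcases le_total m m₀ with hm | hm
    · exact hball m m₀ hm
    · rw [l2_comm]
      exact ((hball m₀ m hm).trans_eq hm₀).trans (hr m)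
  · have hpos : ∀ m, 0 < r m := fun m => (hr m).lt_of_ne fun h => hz ⟨m, h.symm⟩
    choose N K hNK using fun m => exists_l2_le_iff (hpos m)
    obtain ⟨x, hx⟩ := exists_removing_limit c (fun m s => if s < K m then N m + 1 else N m)
      fun m n hmn => simF2_iff.1 ((hNK m _ _).1 (hball m n hmn))
    exact ⟨x, fun m => (hNK m _ _).2 (simF2_iff.2 (hx m))⟩

theorem stmt16 (A : Formula) :
    Nonempty (RA A) ∧
    IsUltrametric (fun a b : RA A => l2 a.1 b.1) ∧
    SphericallyComplete (fun a b : RA A => l2 a.1 b.1) :=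
  ⟨⟨⟨cutMap A, cutMap_nonExpansive2 A, cutMap_removing A⟩⟩, isUltrametric_l2 A,
    sphericallyComplete_l2 A⟩
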